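/- Let a > 0, b > 0, Δ ∈ (0, 1] and c ≥ 0. Let Θ be a random variable with Gamma(a, b + 1) distribution and let Y be a random variable with Gamma(a′, b) distribution, where a′ := b(Δa/(b + 1) + c). Then ΔΘ + c ⪯_cx Y, i.e., E[ΔΘ + c] = E[Y] and E[φ(ΔΘ + c)] ≤ E[φ(Y)] for every convex function φ : ℝ → ℝ such that φ(ΔΘ + c) and φ(Y) are both integrable. -/

import Mathlib

open MeasureTheory ProbabilityTheory

lemma exists_chord (φ : ℝ → ℝ) (hφ : ConvexOn ℝ Set.univ φ) (x1 x2 : ℝ) (h : x1 < x2) :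
    ∃ m p : ℝ, (∀ x ∈ Set.Icc x1 x2, φ x ≤ m * x + p) ∧ (∀ x, x ≤ x1 ∨ x2 ≤ x → m * x + p ≤ φ x) := by
  have hd : 0 < x2 - x1 := by linarith
  refine ⟨(φ x2 - φ x1) / (x2 - x1), φ x1 - (φ x2 - φ x1) / (x2 - x1) * x1, ?_, ?_⟩
  · rintro x ⟨h1, h2⟩
    rcases h1.eq_or_lt with rfl | h1
    · simp
    rcases h2.eq_or_lt with rfl | h2
    · apply le_of_eq; field_simp; ring
    have := hφ.secant_mono_aux1 (Set.mem_univ x1) (Set.mem_univ x2) h1 h2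
    rw [← mul_le_mul_iff_right₀ hd]
    refine this.trans (le_of_eq ?_)
    field_simp; ring
  · rintro x (h1 | h1)
    · rcases h1.eq_or_lt with rfl | h1
      · simp
      have := hφ.secant_mono_aux1 (Set.mem_univ x) (Set.mem_univ x2) h1 h
      rw [← mul_le_mul_iff_right₀ hd]
      refine (le_of_eq ?_).trans (b := (x2 - x) * φ x1 - (x1 - x) * φ x2) (by linarith)
      field_simp; ring
    · rcases h1.eq_or_lt with rfl | h1
      · apply le_of_eq; field_simp; ring
      have := hφ.secant_mono_aux1 (Set.mem_univ x1) (Set.mem_univ x) h h1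
      rw [← mul_le_mul_iff_right₀ hd]
      refine (le_of_eq ?_).trans (b := (x - x1) * φ x2 - (x - x2) * φ x1) (by linarith)
      field_simp; ring

lemma exists_ends (N : Set ℝ) (hN : N.OrdConnected) (hb : BddBelow N) (ha : BddAbove N) :
    ∃ x1 x2 : ℝ, x1 ≤ x2 ∧ Set.Ioo x1 x2 ⊆ N ∧ N ⊆ Set.Icc x1 x2 := by
  rcases N.eq_empty_or_nonempty with rfl | hne
  · exact ⟨0, 0, le_rfl, by simp, by simp⟩
  refine ⟨sInf N, sSup N, csInf_le_csSup hne hb ha, ?_, fun x hx => ⟨csInf_le hb hx, le_csSup ha hx⟩⟩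
  rintro x ⟨h1, h2⟩
  obtain ⟨u, hu, hux⟩ := exists_lt_of_csInf_lt hne h1
  obtain ⟨v, hv, hxv⟩ := exists_lt_of_lt_csSup hne h2
  exact hN.out hu hv ⟨hux.le, hxv.le⟩

lemma cross (f g φ : ℝ → ℝ) (hf : Integrable f) (hg : Integrable g)
    (hfx : Integrable (fun x => x * f x)) (hgx : Integrable (fun x => x * g x))
    (f0 : ∀ x, 0 ≤ f x) (g0 : ∀ x, 0 ≤ g x) (m0 : ∫ x, f x = ∫ x, g x)
    (m1 : ∫ x, x * f x = ∫ x, x * g x)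
    (hN : {x | g x < f x}.OrdConnected) (hNb : BddBelow {x | g x < f x})
    (hNa : BddAbove {x | g x < f x})
    (hφ : ConvexOn ℝ Set.univ φ) (hgφ : Integrable (fun x => φ x * g x)) :
    Integrable (fun x => φ x * f x) ∧ ∫ x, φ x * f x ≤ ∫ x, φ x * g x := by
  obtain ⟨x1, x2, h12, hin, hout⟩ := exists_ends _ hN hNb hNa
  have hout' : ∀ x, x ∉ Set.Icc x1 x2 → f x ≤ g x := fun x hx => by
    by_contra h; exact hx (hout (not_le.1 h))
  have hc : Continuous φ := by
    rw [← continuousOn_univ]; exact hφ.continuousOn isOpen_univ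
  rcases h12.eq_or_lt with rfl | h12
  · have hle : f ≤ᵐ[volume] g := by
      have : ∀ᵐ x : ℝ, x ≠ x1 := by simp [ae_iff]
      filter_upwards [this] with x hx
      exact hout' x (by simpa using hx)
    have heq := (integral_eq_iff_of_ae_le hf hg hle).1 m0
    have : (fun x => φ x * f x) =ᵐ[volume] (fun x => φ x * g x) := by
      filter_upwards [heq] with x hx; rw [hx]
    exact ⟨hgφ.congr this.symm, (integral_congr_ae this).le⟩
  have hfi : Integrable (fun x => φ x * f x) := by
    obtain ⟨C, hC⟩ := isCompact_Icc.exists_bound_of_continuousOn (s := Set.Icc x1 x2) hc.continuousOn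
    refine Integrable.mono' (hgφ.norm.add (hf.const_mul |C|))
      (hc.aestronglyMeasurable.mul hf.aestronglyMeasurable) (Filter.Eventually.of_forall fun x => ?_)
    simp only [Pi.add_apply, norm_mul, Real.norm_of_nonneg (f0 x), Real.norm_of_nonneg (g0 x)]
    by_cases hx : x ∈ Set.Icc x1 x2
    · have : ‖φ x‖ * f x ≤ |C| * f x :=
        mul_le_mul_of_nonneg_right ((hC x hx).trans (le_abs_self C)) (f0 x)
      have : 0 ≤ ‖φ x‖ * g x := mul_nonneg (norm_nonneg _) (g0 x)
      linarith
    · have : ‖φ x‖ * f x ≤ ‖φ x‖ * g x :=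
        mul_le_mul_of_nonneg_left (hout' x hx) (norm_nonneg _)
      have : 0 ≤ |C| * f x := mul_nonneg (abs_nonneg _) (f0 x)
      linarith
  refine ⟨hfi, ?_⟩
  obtain ⟨m, p, hi, ho⟩ := exists_chord φ hφ x1 x2 h12
  have key : ∀ x, φ x * f x + (m * (x * g x) + p * g x) ≤ φ x * g x + (m * (x * f x) + p * f x) := by
    intro x
    have : 0 ≤ (φ x - (m * x + p)) * (g x - f x) := by
      by_cases hx : x ∈ Set.Ioo x1 x2
      · have h1 := hin hx
        simp only [Set.mem_ofPred_eq] at h1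
        have h2 := hi x ⟨hx.1.le, hx.2.le⟩
        exact mul_nonneg_of_nonpos_of_nonpos (by linarith) (by linarith)
      · have h3 : x ≤ x1 ∨ x2 ≤ x := by
          by_contra! h; exact hx h
        have h4 := ho x h3
        by_cases hx' : x ∈ Set.Icc x1 x2
        · have h5 := hi x hx'
          have : φ x - (m * x + p) = 0 := by linarith
          rw [this]; simp
        · have := hout' x hx'
          exact mul_nonneg (by linarith) (by linarith)
    nlinarith
  have i1 : Integrable (fun x => m * (x * g x) + p * g x) := (hgx.const_mul m).add (hg.const_mul p)
  have i2 : Integrable (fun x => m * (x * f x) + p * f x) := (hfx.const_mul m).add (hf.const_mul p)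
  have := integral_mono (hfi.add i1) (hgφ.add i2) key
  simp only [Pi.add_apply] at this
  rw [integral_add hfi i1, integral_add hgφ i2] at this
  rw [integral_add (hgx.const_mul m) (hg.const_mul p), integral_add (hfx.const_mul m) (hf.const_mul p)] at this
  simp only [integral_const_mul] at this
  rw [m0, m1] at this
  linarith

noncomputable def gd (a r x : ℝ) : ℝ :=
  if 0 < x then Real.exp (a * Real.log r - Real.log (Real.Gamma a) + (a - 1) * Real.log x - r * x) else 0

lemma gd_nonneg (a r x : ℝ) : 0 ≤ gd a r x := by
  unfold gd; split_ifs <;> positivity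

lemma gd_ae (a r : ℝ) (ha : 0 < a) (hr : 0 < r) : gammaPDFReal a r =ᵐ[volume] gd a r := by
  have : ∀ᵐ x : ℝ, x ≠ 0 := by simp [ae_iff]
  filter_upwards [this] with x hx
  unfold gammaPDFReal gd
  rcases lt_or_gt_of_ne hx with h | h
  · rw [if_neg (by linarith), if_neg (by linarith)]
  · rw [if_pos h.le, if_pos h, Real.rpow_def_of_pos hr, Real.rpow_def_of_pos h, Real.exp_sub,
      Real.exp_add, Real.exp_sub, Real.exp_log (Real.Gamma_pos_of_pos ha), Real.exp_neg]
    rw [mul_comm (Real.log r), mul_comm (Real.log x)]; rfl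

lemma gd_integrable_iff (a r : ℝ) (ha : 0 < a) (hr : 0 < r) (F : ℝ → ℝ) :
    Integrable F (gammaMeasure a r) ↔ Integrable (fun x => F x * gd a r x) := by
  rw [gammaMeasure, integrable_withDensity_iff (by unfold gammaPDF; fun_prop)
    (by simp [gammaPDF])]
  apply integrable_congr
  filter_upwards [gd_ae a r ha hr] with x hx
  rw [gammaPDF, ENNReal.toReal_ofReal (gammaPDFReal_nonneg ha hr x), hx]

lemma gd_integral (a r : ℝ) (ha : 0 < a) (hr : 0 < r) (F : ℝ → ℝ) :
    ∫ x, F x ∂(gammaMeasure a r) = ∫ x, F x * gd a r x := by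
  rw [gammaMeasure, integral_withDensity_eq_integral_toReal_smul (by unfold gammaPDF; fun_prop)
    (by simp [gammaPDF])]
  apply integral_congr_ae
  filter_upwards [gd_ae a r ha hr] with x hx
  rw [gammaPDF, ENNReal.toReal_ofReal (gammaPDFReal_nonneg ha hr x), hx, smul_eq_mul, mul_comm]

lemma gd_int (a r : ℝ) (ha : 0 < a) (hr : 0 < r) : Integrable (gd a r) := by
  have := isProbabilityMeasure_gammaMeasure ha hr
  simpa using (gd_integrable_iff a r ha hr (fun _ => 1)).1 (integrable_const _)

lemma gd_one (a r : ℝ) (ha : 0 < a) (hr : 0 < r) : ∫ x, gd a r x = 1 := by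
  have := isProbabilityMeasure_gammaMeasure ha hr
  simpa using (gd_integral a r ha hr (fun _ => 1)).symm

lemma gd_mul (a r : ℝ) (ha : 0 < a) (hr : 0 < r) (x : ℝ) : x * gd a r x = a / r * gd (a + 1) r x := by
  unfold gd
  split_ifs with h
  · rw [Real.Gamma_add_one ha.ne', Real.log_mul ha.ne' (Real.Gamma_pos_of_pos ha).ne']
    conv_lhs => rw [← Real.exp_log h, Real.log_exp]
    conv_rhs => rw [← Real.exp_log (div_pos ha hr), Real.log_div ha.ne' hr.ne']
    rw [← Real.exp_add, ← Real.exp_add, Real.exp_log h]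
    congr 1; ring
  · simp

lemma gd_int1 (a r : ℝ) (ha : 0 < a) (hr : 0 < r) : Integrable (fun x => x * gd a r x) := by
  simp_rw [gd_mul a r ha hr]
  exact (gd_int _ _ (by linarith) hr).const_mul _

lemma gd_mean (a r : ℝ) (ha : 0 < a) (hr : 0 < r) : ∫ x, x * gd a r x = a / r := by
  simp_rw [gd_mul a r ha hr]
  rw [integral_const_mul, gd_one _ _ (by linarith) hr, mul_one]

lemma gd_scale (a r D : ℝ) (hr : 0 < r) (hD : 0 < D) (x : ℝ) :
    gd a r x = D * gd a (r / D) (D * x) := by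
  unfold gd
  by_cases h : 0 < x
  · rw [if_pos h, if_pos (by positivity), Real.log_div hr.ne' hD.ne', Real.log_mul hD.ne' h.ne']
    conv_rhs => enter [1]; rw [← Real.exp_log hD]
    rw [← Real.exp_add]
    congr 1; field_simp; ring
  · rw [if_neg h, if_neg (by rw [mul_pos_iff_of_pos_left hD]; exact h)]; simp

lemma step1 (a r k b : ℝ) (φ : ℝ → ℝ) (ha : 0 < a) (hr : 0 < r) (hb : 0 < b) (hbr : b < r)
    (hk : k = a * b / r) (hφ : ConvexOn ℝ Set.univ φ) (hi : Integrable (fun x => φ x * gd k b x)) :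
    Integrable (fun x => φ x * gd a r x) ∧ ∫ x, φ x * gd a r x ≤ ∫ x, φ x * gd k b x := by
  have hk0 : 0 < k := by rw [hk]; positivity
  have hka : k < a := by
    rw [hk, div_lt_iff₀ hr]; nlinarith
  obtain ⟨D, hD⟩ : ∃ D : ℝ, ∀ x, gd k b x < gd a r x ↔
      0 < x ∧ (a - k) * (- Real.log x) + (r - b) * x < D := by
    refine ⟨(a * Real.log r - Real.log (Real.Gamma a)) - (k * Real.log b - Real.log (Real.Gamma k)), fun x => ?_⟩
    unfold gd
    split_ifs with h
    · rw [Real.exp_lt_exp]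
      constructor
      · intro h'; exact ⟨h, by linarith⟩
      · rintro ⟨-, h'⟩; linarith
    · simp [h]
  have hS : {x | gd k b x < gd a r x} =
      {x | x ∈ Set.Ioi (0 : ℝ) ∧ (a - k) * (- Real.log x) + (r - b) * x < D} := by
    ext x; simp only [Set.mem_ofPred_eq, hD, Set.mem_Ioi]
  apply cross _ _ _ (gd_int _ _ ha hr) (gd_int _ _ hk0 hb) (gd_int1 _ _ ha hr) (gd_int1 _ _ hk0 hb)
    (gd_nonneg _ _) (gd_nonneg _ _) _ _ _ _ _ hφ hi
  · rw [gd_one _ _ ha hr, gd_one _ _ hk0 hb]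
  · rw [gd_mean _ _ ha hr, gd_mean _ _ hk0 hb, hk]; field_simp
  · rw [hS]
    apply Convex.ordConnected
    apply ConvexOn.convex_lt
    apply ConvexOn.add
    · have := (strictConcaveOn_log_Ioi.concaveOn.neg).smul (sub_pos.2 hka).le
      exact this
    · have := (convexOn_id (𝕜 := ℝ) (convex_Ioi (0:ℝ))).smul (sub_pos.2 hbr).le
      exact this
  · exact ⟨0, fun x hx => ((hD x).1 hx).1.le⟩
  · have ht : Filter.Tendsto (fun x : ℝ => (a - k) * (- Real.log x) + (r - b) * x) Filter.atTop Filter.atTop := by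
      have h1 : (fun x : ℝ => (a - k) * (- Real.log x)) =o[Filter.atTop] (fun x : ℝ => (r - b) * x) := by
        have := (Real.isLittleO_log_id_atTop.neg_left.const_mul_left (a - k)).const_mul_right (sub_pos.2 hbr).ne'
        exact this
      have h2 : Filter.Tendsto (fun x : ℝ => (r - b) * x) Filter.atTop Filter.atTop :=
        Filter.tendsto_id.const_mul_atTop (sub_pos.2 hbr)
      have h3 := (Asymptotics.IsEquivalent.refl (u := (fun x : ℝ => (r - b) * x)) (l := Filter.atTop)).add_isLittleO h1
      refine (h3.symm.tendsto_atTop h2).congr fun x => ?_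
      simp [add_comm]
    obtain ⟨M, hM⟩ := Filter.eventually_atTop.1 (ht.eventually_ge_atTop D)
    refine ⟨M, fun x hx => ?_⟩
    by_contra! h
    have := hM x h.le
    have := ((hD x).1 hx).2
    linarith

lemma step2 (k b c : ℝ) (φ : ℝ → ℝ) (hk : 0 < k) (hb : 0 < b) (hc : 0 < c)
    (hφ : ConvexOn ℝ Set.univ φ) (hi : Integrable (fun x => φ x * gd (k + b * c) b x)) :
    Integrable (fun x => φ x * gd k b (x - c)) ∧
      ∫ x, φ x * gd k b (x - c) ≤ ∫ x, φ x * gd (k + b * c) b x := by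
  have hK : 0 < k + b * c := by positivity
  set h : ℝ → ℝ := fun x => (k + b * c - 1) * Real.log x - (k - 1) * Real.log (x - c) with hh
  have hder : ∀ x, c < x → HasDerivAt h (c * (b * (x - c) - (k - 1)) / (x * (x - c))) x := by
    intro x hx
    have hx0 : 0 < x := by linarith
    have hx1 : 0 < x - c := by linarith
    have h1 := ((Real.hasDerivAt_log hx0.ne').const_mul (k + b * c - 1)).sub
      ((((hasDerivAt_id x).sub_const c).log hx1.ne').const_mul (k - 1))
    refine h1.congr_deriv ?_
    simp only [id]
    field_simp; ring
  obtain ⟨D, hD⟩ : ∃ D : ℝ, ∀ x, gd (k + b * c) b x < gd k b (x - c) ↔ c < x ∧ h x < D := by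
    refine ⟨(k * Real.log b - Real.log (Real.Gamma k)) -
      ((k + b * c) * Real.log b - Real.log (Real.Gamma (k + b * c))) + b * c, fun x => ?_⟩
    by_cases hx : c < x
    · unfold gd
      rw [if_pos (by linarith), if_pos (by linarith), Real.exp_lt_exp]
      constructor
      · intro h'; exact ⟨hx, by simp only [hh]; linarith⟩
      · rintro ⟨-, h'⟩; simp only [hh] at h'; linarith
    · have : gd k b (x - c) = 0 := by unfold gd; rw [if_neg (by linarith)]
      rw [this]
      simp [hx, gd_nonneg]
  apply cross (fun x => gd k b (x - c)) _ _ ((gd_int _ _ hk hb).comp_sub_right c) (gd_int _ _ hK hb) _ (gd_int1 _ _ hK hb)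
    (fun x => gd_nonneg _ _ _) (gd_nonneg _ _) _ _ _ _ _ hφ hi
  · have := ((gd_int1 _ _ hk hb).add ((gd_int _ _ hk hb).const_mul c)).comp_sub_right c
    refine this.congr (Filter.Eventually.of_forall fun x => ?_)
    simp; ring
  · rw [gd_one _ _ hK hb, integral_sub_right_eq_self (fun x => gd k b x), gd_one _ _ hk hb]
  · rw [gd_mean _ _ hK hb]
    have : ∀ x, x * gd k b (x - c) = (fun y => y * gd k b y + c * gd k b y) (x - c) := by
      intro x; simp; ring
    simp_rw [this]
    rw [integral_sub_right_eq_self (fun y => y * gd k b y + c * gd k b y),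
      integral_add (gd_int1 _ _ hk hb) ((gd_int _ _ hk hb).const_mul c), gd_mean _ _ hk hb,
      integral_const_mul, gd_one _ _ hk hb]
    field_simp
  · constructor
    intro x hx z hz y hy
    simp only [Set.mem_ofPred_eq, hD] at hx hz ⊢
    have hcy : c < y := lt_of_lt_of_le hx.1 hy.1
    refine ⟨hcy, ?_⟩
    rcases le_total (b * (y - c)) (k - 1) with hs | hs
    · have : AntitoneOn h (Set.Icc x y) := by
        apply antitoneOn_of_deriv_nonpos (convex_Icc x y)
        · intro t ht; exact (hder t (lt_of_lt_of_le hx.1 ht.1)).continuousAt.continuousWithinAt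
        · intro t ht; rw [interior_Icc] at ht
          exact (hder t (hx.1.trans ht.1)).differentiableAt.differentiableWithinAt
        · intro t ht; rw [interior_Icc] at ht
          have htc := hx.1.trans ht.1
          rw [(hder t htc).deriv]
          apply div_nonpos_of_nonpos_of_nonneg
          · have : b * (t - c) ≤ b * (y - c) := by gcongr; exact ht.2.le
            exact mul_nonpos_of_nonneg_of_nonpos hc.le (by linarith)
          · exact mul_nonneg (by linarith) (by linarith)
      exact lt_of_le_of_lt (this ⟨le_rfl, hy.1⟩ ⟨hy.1, le_rfl⟩ hy.1) hx.2
    · have : MonotoneOn h (Set.Icc y z) := by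
        apply monotoneOn_of_deriv_nonneg (convex_Icc y z)
        · intro t ht; exact (hder t (lt_of_lt_of_le hcy ht.1)).continuousAt.continuousWithinAt
        · intro t ht; rw [interior_Icc] at ht
          exact (hder t (hcy.trans ht.1)).differentiableAt.differentiableWithinAt
        · intro t ht; rw [interior_Icc] at ht
          have htc := hcy.trans ht.1
          rw [(hder t htc).deriv]
          apply div_nonneg
          · have : b * (y - c) ≤ b * (t - c) := by gcongr; exact ht.1.le
            exact mul_nonneg hc.le (by linarith)
          · exact mul_nonneg (by linarith) (by linarith)
      exact lt_of_le_of_lt (this ⟨le_rfl, hy.2⟩ ⟨hy.2, le_rfl⟩ hy.2) hz.2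
  · exact ⟨c, fun x hx => ((hD x).1 hx).1.le⟩
  · have ht : Filter.Tendsto (fun x : ℝ => (b * c) * Real.log x - |k - 1| * Real.log 2) Filter.atTop Filter.atTop :=
      Filter.tendsto_atTop_add_const_right _ _
        (Real.tendsto_log_atTop.const_mul_atTop (mul_pos hb hc))
    obtain ⟨M, hM⟩ := Filter.eventually_atTop.1 (ht.eventually_ge_atTop D)
    refine ⟨max M (2 * c), fun x hx => ?_⟩
    by_contra! h'
    have h1 := hM x ((le_max_left _ _).trans h'.le)
    have h2c : 2 * c < x := (le_max_right _ _).trans_lt h'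
    have h2 := ((hD x).1 hx).2
    have hx0 : 0 < x := by linarith
    have hx1 : 0 < x - c := by linarith
    have e1 : Real.log (x - c) ≤ Real.log x := Real.log_le_log hx1 (by linarith)
    have e2 : Real.log x ≤ Real.log 2 + Real.log (x - c) := by
      rw [← Real.log_mul (by norm_num) hx1.ne']
      exact Real.log_le_log hx0 (by linarith)
    have e3 : |(k - 1) * (Real.log x - Real.log (x - c))| ≤ |k - 1| * Real.log 2 := by
      rw [abs_mul]
      gcongr
      rw [abs_le]; constructor <;> linarith
    have e4 := neg_le_of_abs_le e3
    simp only [hh] at h2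
    nlinarith

theorem stmt_12 {Ω : Type*} [mΩ : MeasurableSpace Ω] (P : Measure Ω) [IsProbabilityMeasure P]
    (a b Δ c : ℝ) (ha : 0 < a) (hb : 0 < b) (hΔ : Δ ∈ Set.Ioc (0 : ℝ) 1) (hc : 0 ≤ c)
    (Θ Y : Ω → ℝ) (hΘmeas : Measurable Θ) (hYmeas : Measurable Y)
    (hΘ : Measure.map Θ P = gammaMeasure a (b + 1))
    (hY : Measure.map Y P = gammaMeasure (b * (Δ * a / (b + 1) + c)) b) :
    (∫ ω, (Δ * Θ ω + c) ∂P = ∫ ω, Y ω ∂P)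
    ∧ ∀ φ : ℝ → ℝ, ConvexOn ℝ Set.univ φ →
        Integrable (fun ω => φ (Δ * Θ ω + c)) P → Integrable (fun ω => φ (Y ω)) P →
        ∫ ω, φ (Δ * Θ ω + c) ∂P ≤ ∫ ω, φ (Y ω) ∂P := by
  obtain ⟨hΔ0, hΔ1⟩ := hΔ
  have hb1 : 0 < b + 1 := by linarith
  set r := (b + 1) / Δ with hr
  have hr0 : 0 < r := by positivity
  set k := a * b / r with hk
  have hk0 : 0 < k := by positivity
  have hK : b * (Δ * a / (b + 1) + c) = k + b * c := by
    rw [hk, hr]; field_simp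
  rw [hK] at hY
  have hK0 : 0 < k + b * c := by positivity
  have hbr : b < r := by
    rw [hr, lt_div_iff₀ hΔ0]; nlinarith
  have tX : ∀ F : ℝ → ℝ, Continuous F → ∫ ω, F (Δ * Θ ω) ∂P = ∫ x, F x * gd a r x := by
    intro F hF
    have h1 : ∫ ω, F (Δ * Θ ω) ∂P = ∫ x, F (Δ * x) ∂(Measure.map Θ P) := by
      rw [integral_map hΘmeas.aemeasurable]
      exact (hF.comp (by fun_prop)).aestronglyMeasurable
    rw [h1, hΘ, gd_integral _ _ ha hb1]
    have : ∀ x, F (Δ * x) * gd a (b + 1) x = (fun y => Δ * (F y * gd a r y)) (Δ * x) := by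
      intro x; rw [gd_scale a (b + 1) Δ hb1 hΔ0 x]; ring
    simp_rw [this]
    rw [Measure.integral_comp_mul_left (fun y => Δ * (F y * gd a r y)), integral_const_mul,
      abs_of_pos (inv_pos.2 hΔ0), smul_eq_mul, inv_mul_cancel_left₀ hΔ0.ne']
  have tY : ∀ F : ℝ → ℝ, Continuous F → ∫ ω, F (Y ω) ∂P = ∫ x, F x * gd (k + b * c) b x := by
    intro F hF
    rw [← gd_integral _ _ hK0 hb, ← hY, integral_map hYmeas.aemeasurable hF.aestronglyMeasurable]
  constructor
  · rw [tX (fun x => x + c) (by fun_prop), tY (fun x => x) (by fun_prop), gd_mean _ _ hK0 hb]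
    simp_rw [add_mul]
    rw [integral_add (gd_int1 _ _ ha hr0) ((gd_int _ _ ha hr0).const_mul c), gd_mean _ _ ha hr0,
      integral_const_mul, gd_one _ _ ha hr0, hk]
    field_simp
  · intro φ hφ _ hi
    have hcont : Continuous φ := by
      rw [← continuousOn_univ]; exact hφ.continuousOn isOpen_univ
    have hi' : Integrable (fun x => φ x * gd (k + b * c) b x) := by
      rw [← gd_integrable_iff _ _ hK0 hb, ← hY,
        integrable_map_measure hcont.aestronglyMeasurable hYmeas.aemeasurable]
      exact hi
    have hφc : ConvexOn ℝ Set.univ (fun x => φ (x + c)) := by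
      have := hφ.translate_left c
      simpa [Function.comp_def] using this
    rw [tX (fun x => φ (x + c)) (by fun_prop), tY φ hcont]
    have s2 : Integrable (fun x => φ x * gd k b (x - c)) ∧
      ∫ x, φ x * gd k b (x - c) ≤ ∫ x, φ x * gd (k + b * c) b x := by
      rcases hc.eq_or_lt with rfl | hc
      · simpa using hi'
      · exact step2 k b c φ hk0 hb hc hφ hi'
    have i2 : Integrable (fun x => φ (x + c) * gd k b x) := by
      simpa using s2.1.comp_add_right c
    have e2 : ∫ x, φ (x + c) * gd k b x = ∫ x, φ x * gd k b (x - c) := by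
      rw [← integral_add_right_eq_self (fun x => φ x * gd k b (x - c)) c]
      simp
    have s1 := step1 a r k b (fun x => φ (x + c)) ha hr0 hb hbr hk hφc i2
    exact s1.2.trans (e2.le.trans s2.2)
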